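/- For every complex matrix ρ indexed by X, as t → ∞ the evolved state E_t(ρ ⊗ |1̄⟩⟨1̄|) converges (in the finite-dimensional matrix space) to Σ_{c̄ ∈ Fin N → Bool} Π_{c̄} ρ Π_{c̄} ⊗ |c̄⟩⟨c̄|. -/

import Mathlib

open Matrix Filter
open scoped Kronecker Topology

attribute [local instance] Matrix.normedAddCommGroup Matrix.normedSpace

noncomputable section

/-- The computational basis of `n` qubits, `X = {0,1}ⁿ`. -/
abbrev QubitBasis (n : ℕ) := Fin n → Bool

/-- Evaluation of the 3-literal clause with indices `i₁ i₂ i₃` and bits `b₁ b₂ b₃`: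
`C(x) = ¬(x i₁ = b₁ ∧ x i₂ = b₂ ∧ x i₃ = b₃)`. -/
def clauseEval {n : ℕ} (i₁ i₂ i₃ : Fin n) (b₁ b₂ b₃ : Bool) (x : QubitBasis n) : Bool :=
  ! (decide (x i₁ = b₁) && decide (x i₂ = b₂) && decide (x i₃ = b₃))

/-- The Lindblad operator `Lⱼ` attached to the `j`-th clause of an `N`-clause network:
`Lⱼ((x,ā),(y,b̄)) = 1` iff `x = y`, `Cⱼ(x) = false`, `ā j = false`, `b̄ j = true`, and
`ā k = b̄ k` for all `k ≠ j`. -/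
def jumpOpN {n N : ℕ} (C : Fin N → QubitBasis n → Bool) (j : Fin N) :
    Matrix (QubitBasis n × (Fin N → Bool)) (QubitBasis n × (Fin N → Bool)) ℂ :=
  Matrix.of fun p q =>
    if p.1 = q.1 ∧ C j p.1 = false ∧ p.2 j = false ∧ q.2 j = true ∧
        (∀ k, k ≠ j → p.2 k = q.2 k) then 1 else 0

/-- The Lindbladian `ℒ(ρ) = γ (L ρ L† − (1/2)(L†L ρ + ρ L†L))` as a linear endomorphism
of the matrix space. -/
def lindbladian {d : Type*} [Fintype d] [DecidableEq d] (γ : ℝ) (L : Matrix d d ℂ) :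
    Matrix d d ℂ →ₗ[ℂ] Matrix d d ℂ :=
  (γ : ℂ) • ((LinearMap.mulRight ℂ Lᴴ).comp (LinearMap.mulLeft ℂ L)
    - (1 / 2 : ℂ) • (LinearMap.mulLeft ℂ (Lᴴ * L) + LinearMap.mulRight ℂ (Lᴴ * L)))

/-- The evolution `E_t = exp(t·ℒ)`, the exponential of the endomorphism `ℒ`. -/
def evol {d : Type*} [Fintype d] [DecidableEq d]
    (L : Matrix d d ℂ →ₗ[ℂ] Matrix d d ℂ) (t : ℝ) :
    Matrix d d ℂ →L[ℂ] Matrix d d ℂ :=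
  haveI : IsTopologicalRing (Matrix d d ℂ →L[ℂ] Matrix d d ℂ) :=
    (ContinuousLinearMap.toNormedRing (𝕜 := ℂ) (E := Matrix d d ℂ)).toNonUnitalNormedRing.toNonUnitalSeminormedRing.toIsTopologicalRing
  NormedSpace.exp ((t : ℂ) • LinearMap.toContinuousLinearMap L)

/-- The projector `Π_{c̄} = Σ_{x : C̄(x) = c̄} |x⟩⟨x|` onto the decoherence-free subspace
labelled by `c̄ ∈ {0,1}^N`. -/
def dfsProjN {n N : ℕ} (C : Fin N → QubitBasis n → Bool) (cb : Fin N → Bool) :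
    Matrix (QubitBasis n) (QubitBasis n) ℂ :=
  Matrix.diagonal fun x => if (fun j => C j x) = cb then 1 else 0

/-- the single-ancilla factor of the explicit solution. -/
def facF (γ : ℝ) (u v : Bool) (a b : Bool) (t : ℝ) : ℝ :=
  match a, b with
  | true, true => Real.exp (-(γ / 2 * ((if u = false then 1 else 0) + (if v = false then 1 else 0))) * t)
  | false, false => if u = false ∧ v = false then 1 - Real.exp (-γ * t) else 0
  | _, _ => 0

lemma facF_deriv (γ : ℝ) (u v a b : Bool) (t : ℝ) :
    HasDerivAt (facF γ u v a b)
      (γ * ((if (u = false ∧ a = false) ∧ (v = false ∧ b = false) then facF γ u v true true t else 0)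
        - 1 / 2 * (((if u = false ∧ a = true then 1 else 0) + (if v = false ∧ b = true then 1 else 0))
          * facF γ u v a b t))) t := by
  have h : ∀ c : ℝ, HasDerivAt (fun t => Real.exp (c * t)) (Real.exp (c * t) * c) t := by
    intro c
    simpa using ((hasDerivAt_id t).const_mul c).exp
  have key : ∀ (f : ℝ → ℝ) (d d' : ℝ), HasDerivAt f d t → d = d' → HasDerivAt f d' t := by
    intro f d d' h1 h2
    exact h2 ▸ h1
  cases a <;> cases b
  · cases u <;> cases v <;> simp [facF] <;>
      first
      | exact hasDerivAt_const _ _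
      | (refine key _ _ _ ((h (-γ)).const_sub 1) ?_; ring_nf)
  · exact key _ _ _ (hasDerivAt_const t (0:ℝ)) (by simp [facF])
  · exact key _ _ _ (hasDerivAt_const t (0:ℝ)) (by simp [facF])
  · refine key _ _ _ (h _) ?_
    cases u <;> cases v <;> simp [facF] <;> ring

lemma facF_tendsto (γ : ℝ) (hγ : 0 < γ) (u v a b : Bool) :
    Tendsto (facF γ u v a b) atTop (𝓝 (if a = u ∧ a = v ∧ b = u then 1 else 0)) := by
  have h : ∀ c : ℝ, 0 < c → Tendsto (fun t => Real.exp (-(c * t))) atTop (𝓝 0) := by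
    intro c hc
    exact Real.tendsto_exp_neg_atTop_nhds_zero.comp (tendsto_id.const_mul_atTop hc)
  have h1 := h γ hγ
  have h2 := h (γ / 2) (by positivity)
  have h3 : Tendsto (fun t => 1 - Real.exp (-(γ * t))) atTop (𝓝 1) := by
    simpa using h1.const_sub 1
  have e : γ / 2 * (1 + 1) = γ := by ring
  have key : ∀ (f g : ℝ → ℝ) (d : ℝ), Tendsto f atTop (𝓝 d) → (∀ t, f t = g t) →
      Tendsto g atTop (𝓝 d) := by
    intro f g d hf hfg
    exact (funext hfg : f = g) ▸ hf
  cases a <;> cases b <;> cases u <;> cases v <;>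
    simp only [reduceCtorEq, and_true, and_false, true_and, false_and, if_true, if_false] <;>
    first
    | (refine key _ _ _ tendsto_const_nhds ?_; intro t; simp [facF]; done)
    | (refine key _ _ _ h1 ?_; intro t; simp [facF, e]; done)
    | (refine key _ _ _ h2 ?_; intro t; simp [facF]; done)
    | (refine key _ _ _ h3 ?_; intro t; simp [facF]; done)

lemma jump_mul {n N : ℕ} (C : Fin N → QubitBasis n → Bool) (j : Fin N)
    (M : Matrix (QubitBasis n × (Fin N → Bool)) (QubitBasis n × (Fin N → Bool)) ℂ) (p q) :
    (jumpOpN C j * M) p q =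
      if C j p.1 = false ∧ p.2 j = false then M (p.1, Function.update p.2 j true) q else 0 := by
  rw [Matrix.mul_apply]
  rw [Finset.sum_eq_single (p.1, Function.update p.2 j true)]
  · have : (∀ k, k ≠ j → p.2 k = Function.update p.2 j true k) := by
      intro k hk; simp [hk]
    simp only [jumpOpN, Matrix.of_apply, Function.update_self]
    simp only [true_and]
    simp only [eq_true this, and_true, ite_mul, one_mul, zero_mul]
  · rintro ⟨y, b⟩ - hne
    simp only [jumpOpN, Matrix.of_apply]
    rw [if_neg, zero_mul]
    rintro ⟨h1, h2, h3, h4, h5⟩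
    apply hne
    ext k
    · simp [h1]
    · by_cases hk : k = j
      · subst hk; simpa using h4
      · simp [hk, h5 k hk]
  · simp

lemma mul_jumpH {n N : ℕ} (C : Fin N → QubitBasis n → Bool) (j : Fin N)
    (M : Matrix (QubitBasis n × (Fin N → Bool)) (QubitBasis n × (Fin N → Bool)) ℂ) (p q) :
    (M * (jumpOpN C j)ᴴ) p q =
      if C j q.1 = false ∧ q.2 j = false then M p (q.1, Function.update q.2 j true) else 0 := by
  have : M * (jumpOpN C j)ᴴ = (jumpOpN C j * Mᴴ)ᴴ := by simp
  rw [this, Matrix.conjTranspose_apply, jump_mul]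
  split_ifs <;> simp

lemma jumpH_jump {n N : ℕ} (C : Fin N → QubitBasis n → Bool) (j : Fin N) :
    (jumpOpN C j)ᴴ * jumpOpN C j =
      Matrix.diagonal fun p => if C j p.1 = false ∧ p.2 j = true then 1 else 0 := by
  ext p q
  rw [Matrix.mul_apply, Finset.sum_eq_single (p.1, Function.update p.2 j false)]
  · simp only [jumpOpN, Matrix.conjTranspose_apply, Matrix.of_apply, Function.update_self,
      Matrix.diagonal_apply]
    have hh : (∀ k, k ≠ j → Function.update p.2 j false k = p.2 k) := by
      intro k hk; simp [hk]
    by_cases hpq : p = q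
    · subst hpq
      simp only [true_and, eq_true hh, and_true]
      split_ifs <;> simp
    · rw [if_neg hpq]
      by_cases hc : p.2 j = true
      · rw [if_neg (c := _ ∧ _ ∧ _ ∧ q.2 j = true ∧ _), mul_zero]
        rintro ⟨h1, h2, -, h4, h5⟩
        apply hpq
        ext k
        · exact congrFun h1 k
        · by_cases hk : k = j
          · subst hk; rw [hc, h4]
          · rw [← h5 k hk]; simp [hk]
      · simp [hc]
  · rintro ⟨y, b⟩ - hne
    simp only [jumpOpN, Matrix.conjTranspose_apply, Matrix.of_apply]
    rw [if_neg, star_zero, zero_mul]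
    rintro ⟨h1, h2, h3, h4, h5⟩
    apply hne
    ext k
    · exact congrFun h1 k
    · by_cases hk : k = j
      · subst hk; simpa using h3
      · simpa [hk] using h5 k hk
  · simp

lemma lind_apply {n N : ℕ} (C : Fin N → QubitBasis n → Bool) (γ : ℝ) (j : Fin N)
    (M : Matrix (QubitBasis n × (Fin N → Bool)) (QubitBasis n × (Fin N → Bool)) ℂ) (p q) :
    lindbladian γ (jumpOpN C j) M p q =
      (γ : ℂ) * ((if (C j p.1 = false ∧ p.2 j = false) ∧ (C j q.1 = false ∧ q.2 j = false) then
          M (p.1, Function.update p.2 j true) (q.1, Function.update q.2 j true) else 0)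
        - 1 / 2 * (((if C j p.1 = false ∧ p.2 j = true then 1 else 0)
          + (if C j q.1 = false ∧ q.2 j = true then 1 else 0)) * M p q)) := by
  simp only [lindbladian, LinearMap.smul_apply, LinearMap.sub_apply, LinearMap.comp_apply,
    LinearMap.add_apply, LinearMap.mulRight_apply, LinearMap.mulLeft_apply, Matrix.smul_apply,
    Matrix.sub_apply, Matrix.add_apply, smul_eq_mul, jumpH_jump, mul_jumpH, jump_mul,
    Matrix.diagonal_mul, Matrix.mul_diagonal]
  congr 2
  · by_cases h1 : C j p.1 = false ∧ p.2 j = false <;>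
      by_cases h2 : C j q.1 = false ∧ q.2 j = false <;> simp [h1, h2]
  · ring

/-- explicit solution -/
def solF {n N : ℕ} (C : Fin N → QubitBasis n → Bool) (γ : ℝ)
    (ρ : Matrix (QubitBasis n) (QubitBasis n) ℂ) (t : ℝ) :
    Matrix (QubitBasis n × (Fin N → Bool)) (QubitBasis n × (Fin N → Bool)) ℂ :=
  Matrix.of fun p q => ρ p.1 q.1 * ∏ k, ((facF γ (C k p.1) (C k q.1) (p.2 k) (q.2 k) t : ℝ) : ℂ)

lemma solF_deriv {n N : ℕ} (C : Fin N → QubitBasis n → Bool) (γ : ℝ)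
    (ρ : Matrix (QubitBasis n) (QubitBasis n) ℂ) (t : ℝ) :
    HasDerivAt (solF C γ ρ) ((∑ j, lindbladian γ (jumpOpN C j)) (solF C γ ρ t)) t := by
  refine hasDerivAt_pi.2 fun p => hasDerivAt_pi.2 fun q => ?_
  have h := (HasDerivAt.fun_finsetProd (u := Finset.univ) (fun k _ =>
    (facF_deriv γ (C k p.1) (C k q.1) (p.2 k) (q.2 k) t).ofReal_comp)).const_mul (ρ p.1 q.1)
  have e : (∑ j, lindbladian γ (jumpOpN C j)) (solF C γ ρ t) p q =
      ∑ j, lindbladian γ (jumpOpN C j) (solF C γ ρ t) p q := by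
    simp [LinearMap.sum_apply, Matrix.sum_apply]
  refine HasDerivAt.congr_deriv h (Eq.trans ?_ e.symm)
  rw [Finset.mul_sum]
  refine Finset.sum_congr rfl fun j _ => ?_
  rw [lind_apply]
  simp only [solF, Matrix.of_apply]
  have e1 : ∏ k, ((facF γ (C k p.1) (C k q.1) (p.2 k) (q.2 k) t : ℝ) : ℂ) =
      (∏ k ∈ Finset.univ.erase j, ((facF γ (C k p.1) (C k q.1) (p.2 k) (q.2 k) t : ℝ) : ℂ)) *
        ((facF γ (C j p.1) (C j q.1) (p.2 j) (q.2 j) t : ℝ) : ℂ) :=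
    (Finset.prod_erase_mul _ _ (Finset.mem_univ j)).symm
  have e2 : ∏ k, ((facF γ (C k p.1) (C k q.1) (Function.update p.2 j true k)
        (Function.update q.2 j true k) t : ℝ) : ℂ) =
      (∏ k ∈ Finset.univ.erase j, ((facF γ (C k p.1) (C k q.1) (p.2 k) (q.2 k) t : ℝ) : ℂ)) *
        ((facF γ (C j p.1) (C j q.1) true true t : ℝ) : ℂ) := by
    rw [← Finset.prod_erase_mul _ _ (Finset.mem_univ j)]
    congr 1
    · refine Finset.prod_congr rfl fun k hk => ?_
      have := Finset.ne_of_mem_erase hk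
      simp [this]
    · simp
  rw [e1, e2]
  push_cast
  split_ifs <;> simp only [smul_eq_mul, Complex.ofReal_one, Complex.ofReal_zero] <;> ring

lemma solF_zero {n N : ℕ} (C : Fin N → QubitBasis n → Bool) (γ : ℝ)
    (ρ : Matrix (QubitBasis n) (QubitBasis n) ℂ) :
    solF C γ ρ 0 = ρ ⊗ₖ Matrix.single (fun _ => true) (fun _ => true) (1 : ℂ) := by
  ext p q
  have hf : ∀ u v a b, facF γ u v a b 0 = if a = true ∧ b = true then 1 else 0 := by
    intro u v a b
    cases a <;> cases b <;> simp [facF]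
  simp only [solF, Matrix.of_apply, Matrix.kroneckerMap_apply, Matrix.single_apply, hf]
  congr 1
  by_cases h : ((fun _ => true) = p.2 ∧ (fun _ => true) = q.2)
  · rw [if_pos h, ← h.1, ← h.2]; simp
  · rw [if_neg h]
    by_contra hne
    apply h
    rw [Finset.prod_eq_zero_iff] at hne
    push Not at hne
    constructor <;> funext k <;> have := hne k (Finset.mem_univ k) <;> simp at this <;> simp [this]

lemma tendsto_lim_eq {f : ℝ → ℂ} {a b : ℂ} (h : Tendsto f atTop (𝓝 a)) (hab : a = b) :
    Tendsto f atTop (𝓝 b) := hab ▸ h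

lemma exp_unique {E : Type*} [NormedAddCommGroup E] [NormedSpace ℂ E] [CompleteSpace E]
    (A : E →L[ℂ] E) (S : ℝ → E)
    (hS : ∀ t, HasDerivAt S (A (S t)) t) (t : ℝ) :
    NormedSpace.exp ((t : ℂ) • A) (S 0) = S t := by
  have hd : ∀ t : ℝ, HasDerivAt (fun t : ℝ => NormedSpace.exp ((t : ℂ) • A) (S 0))
      (A (NormedSpace.exp ((t : ℂ) • A) (S 0))) t := by
    intro t
    have h := (hasDerivAt_exp_smul_const' (𝕂 := ℂ) A (t : ℂ)).scomp t
      (Complex.ofRealCLM.hasDerivAt (x := t))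
    have h3 := ((ContinuousLinearMap.apply ℂ E (S 0)).restrictScalars ℝ).hasFDerivAt.comp_hasDerivAt t h
    exact HasDerivAt.congr_deriv h3 (by simp)
  have := ODE_solution_unique_univ (v := fun _ x => A x) (s := fun _ => Set.univ) (t₀ := 0)
    (K := ‖A‖₊) (f := fun t : ℝ => NormedSpace.exp ((t : ℂ) • A) (S 0)) (g := S)
    (fun _ => A.lipschitz.lipschitzOnWith) (fun t => ⟨hd t, trivial⟩) (fun t => ⟨hS t, trivial⟩)
    (by simp)
  exact congrFun this t

lemma evol_eq {d : Type*} [Fintype d] [DecidableEq d]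
    (L : Matrix d d ℂ →ₗ[ℂ] Matrix d d ℂ) (S : ℝ → Matrix d d ℂ)
    (hS : ∀ t, HasDerivAt S (L (S t)) t) (t : ℝ) : evol L t (S 0) = S t :=
  exp_unique (E := Matrix d d ℂ) (LinearMap.toContinuousLinearMap L) S hS t

/-- for every matrix `ρ`, `E_t(ρ ⊗ |1̄⟩⟨1̄|)` converges as `t → ∞` to
`Σ_{c̄} Π_{c̄} ρ Π_{c̄} ⊗ |c̄⟩⟨c̄|`. -/
theorem evol_tendsto_dephasedN {n N : ℕ} (hn : 1 ≤ n) (hN : 1 ≤ N)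
    (i₁ i₂ i₃ : Fin N → Fin n)
    (h₁₂ : ∀ j, i₁ j ≠ i₂ j) (h₁₃ : ∀ j, i₁ j ≠ i₃ j) (h₂₃ : ∀ j, i₂ j ≠ i₃ j)
    (b₁ b₂ b₃ : Fin N → Bool) (γ : ℝ) (hγ : 0 < γ)
    (C : Fin N → QubitBasis n → Bool)
    (hC : ∀ j, C j = clauseEval (i₁ j) (i₂ j) (i₃ j) (b₁ j) (b₂ j) (b₃ j))
    (ρ : Matrix (QubitBasis n) (QubitBasis n) ℂ) :
    Tendsto
      (fun t : ℝ => evol (∑ j, lindbladian γ (jumpOpN C j)) t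
        (ρ ⊗ₖ Matrix.single (fun _ => true) (fun _ => true) (1 : ℂ)))
      atTop
      (𝓝 (∑ cb : Fin N → Bool,
        (dfsProjN C cb * ρ * dfsProjN C cb) ⊗ₖ Matrix.single cb cb (1 : ℂ))) := by
  have hev : (fun t : ℝ => evol (∑ j, lindbladian γ (jumpOpN C j)) t
        (ρ ⊗ₖ Matrix.single (fun _ => true) (fun _ => true) (1 : ℂ))) = solF C γ ρ := by
    funext t
    rw [← solF_zero C γ ρ]
    exact evol_eq _ _ (solF_deriv C γ ρ) t
  rw [hev]
  refine tendsto_pi_nhds.2 fun p => tendsto_pi_nhds.2 fun q => ?_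
  have h := (tendsto_finsetProd (Finset.univ : Finset (Fin N)) (fun k _ =>
    (Complex.continuous_ofReal.tendsto _).comp
      (facF_tendsto γ hγ (C k p.1) (C k q.1) (p.2 k) (q.2 k)))).const_mul (ρ p.1 q.1)
  have e : (∑ cb : Fin N → Bool,
        (dfsProjN C cb * ρ * dfsProjN C cb) ⊗ₖ Matrix.single cb cb (1 : ℂ)) p q =
      ∑ cb : Fin N → Bool,
        ((dfsProjN C cb * ρ * dfsProjN C cb) ⊗ₖ Matrix.single cb cb (1 : ℂ)) p q := by
    simp [Matrix.sum_apply]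
  refine tendsto_lim_eq h (Eq.trans ?_ e.symm)
  rw [Finset.sum_eq_single p.2]
  · simp only [dfsProjN, Matrix.kroneckerMap_apply, Matrix.single_apply, Matrix.mul_diagonal,
      Matrix.diagonal_mul, true_and]
    by_cases hall : ∀ k, p.2 k = C k p.1 ∧ p.2 k = C k q.1 ∧ q.2 k = C k p.1
    · have a1 : (fun j => C j p.1) = p.2 := funext fun k => (hall k).1.symm
      have a2 : (fun j => C j q.1) = p.2 := funext fun k => (hall k).2.1.symm
      have a3 : p.2 = q.2 := funext fun k => (hall k).1.trans (hall k).2.2.symm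
      rw [if_pos a1, if_pos a2, if_pos a3, Finset.prod_eq_one]
      · ring
      · intro k _
        rw [if_pos (hall k)]; simp
    · have hz : ∏ k, (((if p.2 k = C k p.1 ∧ p.2 k = C k q.1 ∧ q.2 k = C k p.1 then 1 else 0 : ℝ)) : ℂ) = 0 := by
        push Not at hall
        obtain ⟨k, hk⟩ := hall
        apply Finset.prod_eq_zero (Finset.mem_univ k)
        rw [if_neg]
        · simp
        · rintro ⟨x, y, z⟩
          exact hk x y z
      rw [hz, mul_zero]
      by_contra hne
      apply hall
      have b1 : (fun j => C j p.1) = p.2 := by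
        by_contra hc; apply hne; simp [hc]
      have b2 : (fun j => C j q.1) = p.2 := by
        by_contra hc; apply hne; simp [hc]
      have b3 : p.2 = q.2 := by
        by_contra hc; apply hne; simp [hc]
      intro k
      have c1 := congrFun b1 k
      have c2 := congrFun b2 k
      have c3 := congrFun b3 k
      exact ⟨c1.symm, c2.symm, c3.symm.trans c1.symm⟩
  · intro cb _ hcb
    simp [Matrix.kroneckerMap_apply, Matrix.single_apply, hcb]
  · simp
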